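/- arXiv:1911.02861 — 3 statements merged into one kernel-verified Lean document; each statement's English description precedes it below -/
import Mathlib

section
/- An affine root has constant sign on every facet: for any affine root α = r + n and any facet σ, exactly one of the following holds: α(x) = 0 for all x ∈ σ, or α(x) > 0 for all x ∈ σ, or α(x) < 0 for all x ∈ σ. -/
open Set

/-- The set of affine roots `(r, n)` with `r ∈ R`, `n : ℤ`, vanishing at the point `x`,
i.e. such that `r x + n = 0`.  This is the set `Y_x`. -/
def affineRootsVanishingAt {V : Type*} [NormedAddCommGroup V] [NormedSpace ℝ V]
    (R : Finset (V →ₗ[ℝ] ℝ)) (x : V) : Set ((V →ₗ[ℝ] ℝ) × ℤ) :=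
  {α | α.1 ∈ R ∧ α.1 x + (α.2 : ℝ) = 0}

/-- `H_n`: the set of points where exactly `n` affine roots vanish. -/
def Hset {V : Type*} [NormedAddCommGroup V] [NormedSpace ℝ V]
    (R : Finset (V →ₗ[ℝ] ℝ)) (n : ℕ) : Set V :=
  {x | (affineRootsVanishingAt R x).ncard = n}

/-- A facet is a connected component of some `H_n`. -/
def IsFacet {V : Type*} [NormedAddCommGroup V] [NormedSpace ℝ V]
    (R : Finset (V →ₗ[ℝ] ℝ)) (σ : Set V) : Prop :=
  ∃ (n : ℕ) (x : V), x ∈ Hset R n ∧ σ = connectedComponentIn (Hset R n) x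

theorem affineRootsVanishingAt_finite {V : Type*} [NormedAddCommGroup V] [NormedSpace ℝ V]
    (R : Finset (V →ₗ[ℝ] ℝ)) (x : V) : (affineRootsVanishingAt R x).Finite := by
  refine (R.finite_toSet.image fun r => (r, -⌊r x⌋)).subset ?_
  rintro ⟨r, n⟩ ⟨hr, hn⟩
  refine ⟨r, hr, Prod.ext rfl ?_⟩
  have h : r x = ((-n : ℤ) : ℝ) := by
    push_cast
    linarith
  change -⌊r x⌋ = n
  rw [h, Int.floor_intCast, neg_neg]

/-- Affine roots that do not vanish at `x` do not vanish near `x` either, uniformly. -/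
theorem eventually_affineRootsVanishingAt_subset {V : Type*} [NormedAddCommGroup V]
    [NormedSpace ℝ V] [FiniteDimensional ℝ V] (R : Finset (V →ₗ[ℝ] ℝ)) (x : V) :
    ∀ᶠ y in nhds x, affineRootsVanishingAt R y ⊆ affineRootsVanishingAt R x := by
  have key : ∀ r ∈ R, ∀ᶠ y in nhds x, ∀ n : ℤ, r y + n = 0 → r x + n = 0 := by
    intro r _
    have hc : IsClosed ((fun m : ℤ => (m : ℝ)) '' {m | (m : ℝ) ≠ r x}) :=
      Int.isClosedEmbedding_coe_real.isClosedMap _ (isClosed_discrete _)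
    have hx : r x ∉ (fun m : ℤ => (m : ℝ)) '' {m | (m : ℝ) ≠ r x} := by
      rintro ⟨m, hm, h⟩
      exact hm h
    filter_upwards [r.continuous_of_finiteDimensional.continuousAt.eventually
      (hc.isOpen_compl.mem_nhds hx)] with y hy n hn
    by_contra hne
    refine hy ⟨-n, fun h => hne ?_, ?_⟩
    · rw [← h]
      simp
    · push_cast
      linarith
  filter_upwards [(Filter.eventually_all_finset R).2 key] with y hy
  rintro ⟨r, n⟩ ⟨hr, hn⟩
  exact ⟨hr, hy r hr n hn⟩

/-- The set of vanishing affine roots is constant on preconnected subsets of `H_n`. -/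
theorem affineRootsVanishingAt_eq_of_isPreconnected {V : Type*} [NormedAddCommGroup V]
    [NormedSpace ℝ V] [FiniteDimensional ℝ V] {R : Finset (V →ₗ[ℝ] ℝ)} {n : ℕ} {s : Set V}
    (hs : IsPreconnected s) (hsub : s ⊆ Hset R n) {x y : V} (hx : x ∈ s) (hy : y ∈ s) :
    affineRootsVanishingAt R x = affineRootsVanishingAt R y := by
  refine hs.induction₂ (fun a b => affineRootsVanishingAt R a = affineRootsVanishingAt R b)
    ?_ (fun _ _ _ _ _ _ h₁ h₂ => h₁.trans h₂) (fun _ _ _ _ h => h.symm) hx hy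
  intro a ha
  filter_upwards [nhdsWithin_le_nhds (eventually_affineRootsVanishingAt_subset R a),
    self_mem_nhdsWithin] with b hb hbs
  have hcard : (affineRootsVanishingAt R a).ncard = (affineRootsVanishingAt R b).ncard :=
    (hsub ha).trans (hsub hbs).symm
  exact (Set.eq_of_subset_of_ncard_le hb hcard.le (affineRootsVanishingAt_finite R a)).symm

theorem affine_root_constant_sign_on_facet {V : Type*} [NormedAddCommGroup V] [NormedSpace ℝ V] [FiniteDimensional ℝ V]
    (R : Finset (V →ₗ[ℝ] ℝ)) (hR : ∀ r ∈ R, r ≠ 0)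
    (σ : Set V) (hσ : IsFacet R σ) (r : V →ₗ[ℝ] ℝ) (hr : r ∈ R) (n : ℤ) :
    ((∀ x ∈ σ, r x + n = 0) ∧ ¬ (∀ x ∈ σ, 0 < r x + n) ∧ ¬ (∀ x ∈ σ, r x + n < 0)) ∨
    (¬ (∀ x ∈ σ, r x + n = 0) ∧ (∀ x ∈ σ, 0 < r x + n) ∧ ¬ (∀ x ∈ σ, r x + n < 0)) ∨
    (¬ (∀ x ∈ σ, r x + n = 0) ∧ ¬ (∀ x ∈ σ, 0 < r x + n) ∧ (∀ x ∈ σ, r x + n < 0)) := by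
  obtain ⟨m, x₀, hx₀, rfl⟩ := hσ
  have hmem := mem_connectedComponentIn hx₀
  have hpre : IsPreconnected (connectedComponentIn (Hset R m) x₀) :=
    isPreconnected_connectedComponentIn
  have hsub := connectedComponentIn_subset (Hset R m) x₀
  generalize connectedComponentIn (Hset R m) x₀ = σ at hmem hpre hsub ⊢
  have hzero : ∀ x ∈ σ, ∀ y ∈ σ, r x + n = 0 → r y + n = 0 := by
    intro x hx y hy h
    have hxn : (r, n) ∈ affineRootsVanishingAt R x := ⟨hr, h⟩
    rw [affineRootsVanishingAt_eq_of_isPreconnected hpre hsub hx hy] at hxn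
    exact hxn.2
  have hcont : ContinuousOn (fun x => r x + (n : ℝ)) σ :=
    (r.continuous_of_finiteDimensional.add continuous_const).continuousOn
  have hsign : ∀ x ∈ σ, ∀ y ∈ σ, r x + n < 0 → 0 < r y + n → False := by
    intro x hx y hy hneg hpos
    obtain ⟨z, hz, h⟩ := hpre.intermediate_value hx hy hcont ⟨hneg.le, hpos.le⟩
    exact hneg.ne (hzero z hz x hx h)
  rcases lt_trichotomy (r x₀ + (n : ℝ)) 0 with h | h | h
  · refine Or.inr (Or.inr ⟨fun H => h.ne (H _ hmem), fun H => h.not_gt (H _ hmem), ?_⟩)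
    intro x hx
    rcases lt_trichotomy (r x + (n : ℝ)) 0 with h' | h' | h'
    · exact h'
    · exact absurd (hzero x hx x₀ hmem h') h.ne
    · exact (hsign x₀ hmem x hx h h').elim
  · exact Or.inl ⟨fun x hx => hzero x₀ hmem x hx h, fun H => (H _ hmem).ne' h,
      fun H => (H _ hmem).ne h⟩
  · refine Or.inr (Or.inl ⟨fun H => h.ne' (H _ hmem), ?_, fun H => h.not_gt (H _ hmem)⟩)
    intro x hx
    rcases lt_trichotomy (r x + (n : ℝ)) 0 with h' | h' | h'
    · exact (hsign x hx x₀ hmem h' h).elim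
    · exact absurd (hzero x hx x₀ hmem h') h.ne'
    · exact h'
end

section
/- Dichotomy for the values of a root on a facet: for any facet σ and any r ∈ R, either r is constant on σ with integer value, or there exists an integer n such that r(x) ∈ (n, n+1) for every x ∈ σ. -/
open Set

open Topology in
theorem eventually_notMem_range_intCast {V : Type*} [TopologicalSpace V] {f : V → ℝ} {x : V}
    (hf : ContinuousAt f x) (hx : f x ∉ range ((↑) : ℤ → ℝ)) :
    ∀ᶠ y in 𝓝 x, f y ∉ range ((↑) : ℤ → ℝ) :=
  hf.eventually (Int.isClosedEmbedding_coe_real.isClosed_range.isOpen_compl.mem_nhds hx)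

/-- The roots taking an integer value at `x` are counted by the affine roots vanishing at `x`. -/
theorem ncard_affineRootsVanishingAt {V : Type*} [NormedAddCommGroup V] [NormedSpace ℝ V]
    (R : Finset (V →ₗ[ℝ] ℝ)) (x : V) :
    (affineRootsVanishingAt R x).ncard = {r | r ∈ R ∧ r x ∈ range ((↑) : ℤ → ℝ)}.ncard := by
  have himage : Prod.fst '' affineRootsVanishingAt R x =
      {r | r ∈ R ∧ r x ∈ range ((↑) : ℤ → ℝ)} := by
    ext r
    constructor
    · rintro ⟨⟨r, n⟩, ⟨hr, h⟩, rfl⟩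
      refine ⟨hr, -n, ?_⟩
      push_cast
      dsimp only at h ⊢
      linarith
    · rintro ⟨hr, n, hn⟩
      exact ⟨(r, -n), ⟨hr, by simp [← hn]⟩, rfl⟩
  rw [← himage, InjOn.ncard_image]
  rintro ⟨r, m⟩ ⟨-, hm⟩ ⟨r', m'⟩ ⟨-, hm'⟩ h
  obtain rfl : r = r' := h
  have : (m : ℝ) = m' := by
    dsimp only at hm hm'
    linarith
  rw [Int.cast_injective this]

open Topology in
/-- On `H_n`, the set of roots taking an integer value is locally constant. -/
theorem eventually_mem_range_intCast_iff {V : Type*} [NormedAddCommGroup V] [NormedSpace ℝ V]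
    [FiniteDimensional ℝ V] (R : Finset (V →ₗ[ℝ] ℝ)) {n : ℕ} {x : V} (hx : x ∈ Hset R n)
    {r : V →ₗ[ℝ] ℝ} (hr : r ∈ R) :
    ∀ᶠ y in 𝓝[Hset R n] x,
      (r x ∈ range ((↑) : ℤ → ℝ) ↔ r y ∈ range ((↑) : ℤ → ℝ)) := by
  have hnear : ∀ᶠ y in 𝓝 x, ∀ s ∈ R, s x ∉ range ((↑) : ℤ → ℝ) →
      s y ∉ range ((↑) : ℤ → ℝ) := by
    rw [Filter.eventually_all_finset]
    intro s _
    by_cases hs : s x ∈ range ((↑) : ℤ → ℝ)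
    · exact .of_forall fun _ h => absurd hs h
    · filter_upwards [eventually_notMem_range_intCast
        s.continuous_of_finiteDimensional.continuousAt hs] with y hy _ using hy
  filter_upwards [hnear.filter_mono nhdsWithin_le_nhds, self_mem_nhdsWithin] with y hy hyn
  have hsub : {s | s ∈ R ∧ s y ∈ range ((↑) : ℤ → ℝ)} ⊆
      {s | s ∈ R ∧ s x ∈ range ((↑) : ℤ → ℝ)} :=
    fun s hs => ⟨hs.1, by_contra fun h => hy s hs.1 h hs.2⟩
  have hcard : {s | s ∈ R ∧ s x ∈ range ((↑) : ℤ → ℝ)}.ncard ≤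
      {s | s ∈ R ∧ s y ∈ range ((↑) : ℤ → ℝ)}.ncard := by
    rw [← ncard_affineRootsVanishingAt, ← ncard_affineRootsVanishingAt]
    exact (Eq.trans hx (Eq.symm hyn)).le
  have heq := eq_of_subset_of_ncard_le hsub hcard
    (R.finite_toSet.subset fun s hs => hs.1)
  have := Set.ext_iff.mp heq r
  simp only [mem_ofPred_eq, hr, true_and] at this
  exact this.symm

/-- A preconnected set of integers in `ℝ` has at most one element. -/
theorem IsPreconnected.subsingleton_of_subset_range_intCast {s : Set ℝ} (hs : IsPreconnected s)
    (h : s ⊆ range ((↑) : ℤ → ℝ)) : s.Subsingleton := by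
  have key : ∀ a b : ℤ, (a : ℝ) ∈ s → (b : ℝ) ∈ s → b ≤ a := by
    intro a b ha hb
    by_contra! hab
    have hab' : (a : ℝ) + 1 ≤ b := by exact_mod_cast hab
    obtain ⟨c, hc⟩ := h (hs.ordConnected.out ha hb
      (show (a : ℝ) + 1 / 2 ∈ Icc (a : ℝ) b from ⟨by linarith, by linarith⟩))
    have h₁ : a < c := by exact_mod_cast (by linarith : (a : ℝ) < c)
    have h₂ : c < a + 1 := by exact_mod_cast (by linarith : (c : ℝ) < a + 1)
    lia
  intro x hx y hy
  obtain ⟨a, rfl⟩ := h hx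
  obtain ⟨b, rfl⟩ := h hy
  rw [le_antisymm (key b a hy hx) (key a b hx hy)]

theorem root_value_dichotomy_on_facet {V : Type*} [NormedAddCommGroup V] [NormedSpace ℝ V] [FiniteDimensional ℝ V]
    (R : Finset (V →ₗ[ℝ] ℝ)) (hR : ∀ r ∈ R, r ≠ 0)
    (σ : Set V) (hσ : IsFacet R σ) (r : V →ₗ[ℝ] ℝ) (hr : r ∈ R) :
    (∃ m : ℤ, ∀ x ∈ σ, r x = m) ∨
      (∃ n : ℤ, ∀ x ∈ σ, (n : ℝ) < r x ∧ r x < n + 1) := by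
  obtain ⟨n, x, hx, rfl⟩ := hσ
  have hσ := isPreconnected_connectedComponentIn (F := Hset R n) (x := x)
  have hsub := connectedComponentIn_subset (Hset R n) x
  have hxσ := mem_connectedComponentIn hx
  have himage := hσ.image r r.continuous_of_finiteDimensional.continuousOn
  have hconst : ∀ y ∈ connectedComponentIn (Hset R n) x,
      (r x ∈ range ((↑) : ℤ → ℝ) ↔ r y ∈ range ((↑) : ℤ → ℝ)) := fun y hy =>
    hσ.induction₂ (fun y z => r y ∈ range ((↑) : ℤ → ℝ) ↔ r z ∈ range ((↑) : ℤ → ℝ))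
      (fun y hy => (eventually_mem_range_intCast_iff R (hsub hy) hr).filter_mono
        (nhdsWithin_mono y hsub))
      (fun _ _ _ _ _ _ => Iff.trans) (fun _ _ _ _ => Iff.symm) hxσ hy
  by_cases hrx : r x ∈ range ((↑) : ℤ → ℝ)
  · left
    have hsingle := himage.subsingleton_of_subset_range_intCast
      (image_subset_iff.mpr fun y hy => (hconst y hy).mp hrx)
    obtain ⟨m, hm⟩ := hrx
    exact ⟨m, fun y hy =>
      (hsingle (mem_image_of_mem r hy) (mem_image_of_mem r hxσ)).trans hm.symm⟩
  · right
    have hmiss : ∀ k : ℤ, (k : ℝ) ∉ r '' connectedComponentIn (Hset R n) x := by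
      rintro k ⟨y, hy, hk⟩
      exact hrx ((hconst y hy).mpr ⟨k, hk.symm⟩)
    refine ⟨⌊r x⌋, fun y hy => ⟨?_, ?_⟩⟩
    · by_contra! h
      exact hmiss _ (himage.ordConnected.out (mem_image_of_mem r hy) (mem_image_of_mem r hxσ)
        ⟨h, Int.floor_le _⟩)
    · by_contra! h
      refine hmiss (⌊r x⌋ + 1) (himage.ordConnected.out (mem_image_of_mem r hxσ)
        (mem_image_of_mem r hy) ⟨?_, ?_⟩) <;> push_cast
      · exact (Int.lt_floor_add_one _).le
      · exact h
end

section
/- If s and b are facets with s contained in the closure of b, then for every p ∈ s and q ∈ b the open segment {(1−t)p + tq : 0 < t < 1} is entirely contained in b. -/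
open Set

section Facets

variable {V : Type*} [NormedAddCommGroup V] [NormedSpace ℝ V] {R : Finset (V →ₗ[ℝ] ℝ)}

open Classical in
/-- The roots taking an integral value at `x`. -/
noncomputable def integralRoots (R : Finset (V →ₗ[ℝ] ℝ)) (x : V) : Finset (V →ₗ[ℝ] ℝ) :=
  R.filter fun r => ∃ m : ℤ, r x = m

theorem mem_integralRoots {x : V} {r : V →ₗ[ℝ] ℝ} :
    r ∈ integralRoots R x ↔ r ∈ R ∧ ∃ m : ℤ, r x = m := by
  simp [integralRoots]

theorem ncard_affineRootsVanishingAt_s10 (x : V) :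
    (affineRootsVanishingAt R x).ncard = (integralRoots R x).card := by
  have himage : Prod.fst '' affineRootsVanishingAt R x = (integralRoots R x : Set (V →ₗ[ℝ] ℝ)) := by
    ext r
    simp only [mem_image, Finset.mem_coe, mem_integralRoots]
    constructor
    · rintro ⟨⟨r', m⟩, ⟨hr, hm⟩, rfl⟩
      refine ⟨hr, -m, ?_⟩
      push_cast
      linarith
    · rintro ⟨hr, m, hm⟩
      exact ⟨(r, -m), ⟨hr, by simp [hm]⟩, rfl⟩
  rw [← Set.ncard_coe_finset, ← himage, Set.InjOn.ncard_image]
  rintro ⟨r, m⟩ ⟨_, hm⟩ ⟨r', m'⟩ ⟨_, hm'⟩ h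
  obtain rfl : r = r' := h
  have : (m : ℝ) = m' := by
    simp only at hm hm'
    linarith
  simpa using this

theorem mem_Hset_iff {n : ℕ} {x : V} : x ∈ Hset R n ↔ (integralRoots R x).card = n := by
  rw [← ncard_affineRootsVanishingAt_s10]
  rfl

theorem exists_int_eq_iff_ceil_le_floor {a : ℝ} : (∃ m : ℤ, a = m) ↔ ⌈a⌉ ≤ ⌊a⌋ := by
  constructor
  · rintro ⟨m, rfl⟩
    simp
  · intro h
    refine ⟨⌊a⌋, le_antisymm ((Int.le_ceil a).trans ?_) (Int.floor_le a)⟩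
    exact_mod_cast h

theorem integralRoots_congr {x y : V}
    (h : ∀ r ∈ R, ⌊r x⌋ = ⌊r y⌋ ∧ ⌈r x⌉ = ⌈r y⌉) : integralRoots R x = integralRoots R y := by
  ext r
  simp only [mem_integralRoots, exists_int_eq_iff_ceil_le_floor]
  refine and_congr_right fun hr => ?_
  rw [(h r hr).1, (h r hr).2]

/-- Near a point of `Hset R n`, the integer parts of the roots are constant on `Hset R n`. -/
theorem eventually_floor_eq_and_ceil_eq [FiniteDimensional ℝ V] {n : ℕ} {x : V}
    (hx : x ∈ Hset R n) :
    ∀ᶠ y in nhdsWithin x (Hset R n), ∀ r ∈ R, ⌊r y⌋ = ⌊r x⌋ ∧ ⌈r y⌉ = ⌈r x⌉ := by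
  have hnear : ∀ᶠ y in nhds x, ∀ r ∈ R, (⌈r x⌉ : ℝ) - 1 < r y ∧ r y < ⌊r x⌋ + 1 := by
    refine (Filter.eventually_all_finset R).2 fun r _ => ?_
    have hr : Continuous r := r.continuous_of_finiteDimensional
    exact (hr.continuousAt.eventually_const_lt (by linarith [Int.ceil_lt_add_one (r x)])).and
      (hr.continuousAt.eventually_lt_const (Int.lt_floor_add_one (r x)))
  filter_upwards [nhdsWithin_le_nhds hnear, self_mem_nhdsWithin] with y hy hyn
  have hint : ∀ r ∈ R, ∀ m : ℤ, r y = m → r x = m := by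
    intro r hr m hm
    obtain ⟨h₁, h₂⟩ := hy r hr
    rw [hm] at h₁ h₂
    have h₃ : ⌈r x⌉ ≤ m := by
      have : ⌈r x⌉ - 1 < m := by exact_mod_cast h₁
      omega
    have h₄ : m ≤ ⌊r x⌋ := by
      have : m < ⌊r x⌋ + 1 := by exact_mod_cast h₂
      omega
    exact le_antisymm (Int.ceil_le.1 h₃) (Int.le_floor.1 h₄)
  have heq : integralRoots R y = integralRoots R x := by
    refine Finset.eq_of_subset_of_card_le (fun r hr => ?_)
      (by rw [mem_Hset_iff.1 hx, mem_Hset_iff.1 hyn])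
    obtain ⟨hrR, m, hm⟩ := mem_integralRoots.1 hr
    exact mem_integralRoots.2 ⟨hrR, m, hint r hrR m hm⟩
  intro r hr
  by_cases hrx : r ∈ integralRoots R x
  · obtain ⟨-, m, hm⟩ := mem_integralRoots.1 (heq ▸ hrx)
    rw [hm, hint r hr m hm]
    exact ⟨rfl, rfl⟩
  · have hlt : ⌊r x⌋ < ⌈r x⌉ := by
      by_contra! hle
      exact hrx (mem_integralRoots.2 ⟨hr, exists_int_eq_iff_ceil_le_floor.2 hle⟩)
    have hceil : ⌈r x⌉ = ⌊r x⌋ + 1 := le_antisymm (Int.ceil_le_floor_add_one _) hlt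
    obtain ⟨h₁, h₂⟩ := hy r hr
    have hceil' : (⌈r x⌉ : ℝ) = ⌊r x⌋ + 1 := by exact_mod_cast hceil
    rw [Int.floor_eq_iff, Int.ceil_eq_iff]
    refine ⟨⟨?_, ?_⟩, ?_, ?_⟩ <;> linarith

theorem IsPreconnected.floor_eq_and_ceil_eq [FiniteDimensional ℝ V] {n : ℕ} {b : Set V}
    (hb : IsPreconnected b) (hbn : b ⊆ Hset R n) {x y : V} (hx : x ∈ b) (hy : y ∈ b)
    {r : V →ₗ[ℝ] ℝ} (hr : r ∈ R) : ⌊r x⌋ = ⌊r y⌋ ∧ ⌈r x⌉ = ⌈r y⌉ := by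
  have hcont : ContinuousOn (fun z => (⌊r z⌋, ⌈r z⌉)) b := fun z hz => by
    refine tendsto_const_nhds.congr' ?_
    filter_upwards [nhdsWithin_mono z hbn (eventually_floor_eq_and_ceil_eq (hbn hz))] with w hw
    rw [(hw r hr).1, (hw r hr).2]
  exact Prod.ext_iff.1 (hb.constant hcont hx hy)

/-- If `c` lies between the integer parts of `a`, so do all points strictly between `c` and `a`,
and they have the same integer parts as `a`. -/
theorem floor_eq_and_ceil_eq_of_mem_Icc {a c t : ℝ} (hc : c ∈ Icc (⌊a⌋ : ℝ) ⌈a⌉)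
    (ht₀ : 0 < t) (ht₁ : t ≤ 1) :
    ⌊(1 - t) * c + t * a⌋ = ⌊a⌋ ∧ ⌈(1 - t) * c + t * a⌉ = ⌈a⌉ := by
  obtain ⟨h₁, h₂⟩ := hc
  by_cases hle : ⌈a⌉ ≤ ⌊a⌋
  · obtain ⟨m, rfl⟩ := exists_int_eq_iff_ceil_le_floor.2 hle
    rw [Int.floor_intCast] at h₁
    rw [Int.ceil_intCast] at h₂
    obtain rfl : c = m := le_antisymm h₂ h₁
    rw [show (1 - t) * (m : ℝ) + t * m = m by ring]
    exact ⟨rfl, rfl⟩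
  · have hceil : (⌈a⌉ : ℝ) = ⌊a⌋ + 1 := by
      exact_mod_cast le_antisymm (Int.ceil_le_floor_add_one a) (not_le.1 hle)
    have h₃ := Int.lt_floor_add_one a
    have h₄ : (⌊a⌋ : ℝ) < a := by linarith [Int.ceil_lt_add_one a]
    rw [Int.floor_eq_iff, Int.ceil_eq_iff]
    refine ⟨⟨?_, ?_⟩, ?_, ?_⟩ <;>
      nlinarith [mul_nonneg (sub_nonneg.2 ht₁) (sub_nonneg.2 h₁),
        mul_nonneg (sub_nonneg.2 ht₁) (sub_nonneg.2 h₂),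
        mul_pos ht₀ (sub_pos.2 h₃), mul_pos ht₀ (sub_pos.2 h₄)]

end Facets

theorem open_segment_subset_facet {V : Type*} [NormedAddCommGroup V] [NormedSpace ℝ V] [FiniteDimensional ℝ V]
    (R : Finset (V →ₗ[ℝ] ℝ)) (hR : ∀ r ∈ R, r ≠ 0)
    (s b : Set V) (hs : IsFacet R s) (hb : IsFacet R b) (hsb : s ⊆ closure b) :
    ∀ p ∈ s, ∀ q ∈ b, ∀ t : ℝ, 0 < t → t < 1 → (1 - t) • p + t • q ∈ b := by
  intro p hp q hq t ht₀ ht₁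
  obtain ⟨n, x, hx, rfl⟩ := hb
  have hbn := connectedComponentIn_subset (Hset R n) x
  have hpq : ∀ r ∈ R, r p ∈ Icc (⌊r q⌋ : ℝ) ⌈r q⌉ := fun r hr => by
    have hcont : Continuous r := r.continuous_of_finiteDimensional
    refine closure_minimal (fun y hy => ?_) (isClosed_Icc.preimage hcont) (hsb hp)
    obtain ⟨hfloor, hceil⟩ :=
      isPreconnected_connectedComponentIn.floor_eq_and_ceil_eq hbn hq hy hr
    rw [mem_preimage, hfloor, hceil]
    exact ⟨Int.floor_le _, Int.le_ceil _⟩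
  let f : ℝ → V := fun u => (1 - u) • p + u • q
  have hf : Continuous f := by fun_prop
  have hmaps : f '' Ioc 0 1 ⊆ Hset R n := by
    rintro _ ⟨u, ⟨hu₀, hu₁⟩, rfl⟩
    rw [mem_Hset_iff, ← mem_Hset_iff.1 (hbn hq)]
    refine congrArg Finset.card (integralRoots_congr fun r hr => ?_)
    simpa [f] using floor_eq_and_ceil_eq_of_mem_Icc (hpq r hr) hu₀ hu₁
  rw [connectedComponentIn_eq hq]
  exact (isPreconnected_Ioc.image f hf.continuousOn).subset_connectedComponentIn
    ⟨1, by simp, by simp [f]⟩ hmaps ⟨t, ⟨ht₀, ht₁.le⟩, rfl⟩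
end
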